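/- (Carnot's theorem for generalized constraints.) The kinetic energy can only decrease under the jump rule: for every p₋ ∈ ℝⁿ, ½ (P p₋)ᵀ g⁻¹ (P p₋) ≤ ½ p₋ᵀ g⁻¹ p₋. -/

import Mathlib

open Matrix

/-- Carnot's theorem for generalized constraints: the kinetic energy can only decrease
under the jump rule `p₊ = P pm`, where `P = I - ωᵀ C⁻¹ ω g⁻¹` and `C = ω g⁻¹ ωᵀ`. -/
theorem carnot_kinetic_energy_decreases
    {n s : ℕ} (hn : 0 < n) (hs : 0 < s)
    (g : Matrix (Fin n) (Fin n) ℝ) (hg : g.PosDef)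
    (ω : Matrix (Fin s) (Fin n) ℝ) (hω : LinearIndependent ℝ (fun i => ω i))
    (C : Matrix (Fin s) (Fin s) ℝ) (hC : C = ω * g⁻¹ * ωᵀ)
    (P : Matrix (Fin n) (Fin n) ℝ) (hP : P = 1 - ωᵀ * C⁻¹ * ω * g⁻¹) :
    ∀ pm : Fin n → ℝ,
      (1 / 2) * ((P *ᵥ pm) ⬝ᵥ (g⁻¹ *ᵥ (P *ᵥ pm))) ≤ (1 / 2) * (pm ⬝ᵥ (g⁻¹ *ᵥ pm)) := by
  intro pm
  have hG : (g⁻¹).PosSemidef := hg.inv.posSemidef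
  have hGt : (g⁻¹)ᵀ = g⁻¹ := by simpa using hG.isHermitian.eq
  have hCp : C.PosSemidef := by
    have := hG.mul_mul_conjTranspose_same ω
    rw [conjTranspose_eq_transpose_of_trivial] at this
    rwa [hC]
  have hK : (C⁻¹).PosSemidef := hCp.inv
  have hKt : (C⁻¹)ᵀ = C⁻¹ := by simpa using hK.isHermitian.eq
  have hKCK : C⁻¹ * C * C⁻¹ = C⁻¹ := by
    by_cases h : IsUnit C.det
    · rw [nonsing_inv_mul _ h, one_mul]
    · rw [nonsing_inv_apply_not_isUnit _ h]; simp
  have hnn := hK.dotProduct_mulVec_nonneg ((ω * g⁻¹) *ᵥ pm)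
  have key : Pᵀ * g⁻¹ * P = g⁻¹ - (ω * g⁻¹)ᵀ * C⁻¹ * (ω * g⁻¹) := by
    have h2 : (g⁻¹ * ωᵀ) * (C⁻¹ * (ω * g⁻¹ * ωᵀ) * C⁻¹) * (ω * g⁻¹)
        = (g⁻¹ * ωᵀ) * C⁻¹ * (ω * g⁻¹) := by
      rw [← hC, hKCK]
    simp only [Matrix.mul_assoc] at h2
    rw [hP]
    simp only [transpose_sub, transpose_mul, transpose_one, transpose_transpose, hGt, hKt,
      Matrix.sub_mul, Matrix.mul_sub, Matrix.one_mul, Matrix.mul_one, Matrix.mul_assoc, h2]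
    abel
  have e1 : (P *ᵥ pm) ⬝ᵥ (g⁻¹ *ᵥ (P *ᵥ pm)) = pm ⬝ᵥ ((Pᵀ * g⁻¹ * P) *ᵥ pm) := by
    rw [← mulVec_mulVec, ← mulVec_mulVec, dotProduct_mulVec pm Pᵀ, vecMul_transpose]
  have e2 : ((ω * g⁻¹) *ᵥ pm) ⬝ᵥ (C⁻¹ *ᵥ ((ω * g⁻¹) *ᵥ pm))
      = pm ⬝ᵥ (((ω * g⁻¹)ᵀ * C⁻¹ * (ω * g⁻¹)) *ᵥ pm) := by
    generalize ω * g⁻¹ = A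
    rw [← mulVec_mulVec, ← mulVec_mulVec, dotProduct_mulVec pm Aᵀ, vecMul_transpose]
  rw [star_trivial, e2] at hnn
  rw [e1, key, sub_mulVec, dotProduct_sub]
  linarith
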